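/- Let T be a conditional expectation operator on L^∞([0,1], Borel, Lebesgue) (i.e. T f = E(f | 𝒢) for a sub-σ-algebra 𝒢 of the Borel σ-algebra, with respect to Lebesgue measure), arising as the Markov operator of a 2-copula. Then T maps all decreasing functions to decreasing functions (or all decreasing functions to increasing functions) if and only if there is a countable family of disjoint open intervals (a_k,b_k) ⊆ (0,1) with union P such that T f(u) = Σ_k 1_{(a_k,b_k)}(u) · (1/(b_k−a_k)) ∫_{a_k}^{b_k} f(t) dt + 1_{Pᶜ}(u) f(u) for a.e. u. -/

import Mathlib

open MeasureTheory Set Filter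

def IsCopula (C : ℝ → ℝ → ℝ) : Prop :=
  (∀ u ∈ Icc (0:ℝ) 1, C u 0 = 0 ∧ C u 1 = u) ∧
  (∀ v ∈ Icc (0:ℝ) 1, C 0 v = 0 ∧ C 1 v = v) ∧
  (∀ u₁ u₂ v₁ v₂ : ℝ, u₁ ∈ Icc (0:ℝ) 1 → u₂ ∈ Icc (0:ℝ) 1 →
    v₁ ∈ Icc (0:ℝ) 1 → v₂ ∈ Icc (0:ℝ) 1 → u₁ ≤ u₂ → v₁ ≤ v₂ →
    0 ≤ C u₂ v₂ - C u₂ v₁ - C u₁ v₂ + C u₁ v₁)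

/-- Markov product of two copulas: (C₁ * C₂)(u,v) = ∫₀¹ ∂₂C₁(u,t) ∂₁C₂(t,v) dt. -/
noncomputable def MarkovProduct (C₁ C₂ : ℝ → ℝ → ℝ) (u v : ℝ) : ℝ :=
  ∫ t in (0:ℝ)..1, deriv (fun s => C₁ u s) t * deriv (fun s => C₂ s v) t

/-- Stochastically increasing in the first component: u ↦ C(u,v) is concave for each v. -/
def StochIncr (C : ℝ → ℝ → ℝ) : Prop :=
  ∀ v ∈ Icc (0:ℝ) 1, ConcaveOn ℝ (Icc (0:ℝ) 1) (fun u => C u v)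

/-- Stochastically decreasing in the first component: u ↦ C(u,v) is convex for each v. -/
def StochDecr (C : ℝ → ℝ → ℝ) : Prop :=
  ∀ v ∈ Icc (0:ℝ) 1, ConvexOn ℝ (Icc (0:ℝ) 1) (fun u => C u v)

/-- The Markov operator associated to a copula: T_C f (u) = ∂_u ∫₀¹ ∂_v C(u,v) f(v) dv. -/
noncomputable def MarkovOp (C : ℝ → ℝ → ℝ) (f : ℝ → ℝ) (u : ℝ) : ℝ :=
  deriv (fun x => ∫ v in (0:ℝ)..1, deriv (fun w => C x w) v * f v) u

theorem IsCopula.swap {C : ℝ → ℝ → ℝ} (hC : IsCopula C) : IsCopula (fun u v => C v u) := by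
  refine ⟨fun u hu => hC.2.1 u hu, fun u hu => hC.1 u hu, ?_⟩
  intro u₁ u₂ v₁ v₂ h1 h2 h3 h4 h5 h6
  have := hC.2.2 v₁ v₂ u₁ u₂ h3 h4 h1 h2 h6 h5
  linarith

theorem IsCopula.mono {C : ℝ → ℝ → ℝ} (hC : IsCopula C) {x : ℝ} (hx : x ∈ Icc (0:ℝ) 1) :
    MonotoneOn (C x) (Icc 0 1) := by
  intro v hv w hw hvw
  have := hC.2.2 0 x v w (by simp) hx hv hw hx.1 hvw
  have h1 := (hC.2.1 v hv).1
  have h2 := (hC.2.1 w hw).1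
  linarith

theorem IsCopula.mono_sub {C : ℝ → ℝ → ℝ} (hC : IsCopula C) {x y : ℝ} (hx : x ∈ Icc (0:ℝ) 1)
    (hy : y ∈ Icc (0:ℝ) 1) (hxy : x ≤ y) :
    MonotoneOn (fun v => C y v - C x v) (Icc 0 1) := by
  intro v hv w hw hvw
  have := hC.2.2 x y v w hx hy hv hw hxy hvw
  dsimp only
  linarith

theorem IsCopula.sub_le {C : ℝ → ℝ → ℝ} (hC : IsCopula C) {x v w : ℝ} (hx : x ∈ Icc (0:ℝ) 1)
    (hv : v ∈ Icc (0:ℝ) 1) (hw : w ∈ Icc (0:ℝ) 1) (hvw : v ≤ w) : C x w - C x v ≤ w - v := by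
  have := hC.2.2 x 1 v w hx (by simp) hv hw hx.2 hvw
  have h1 := (hC.2.1 v hv).2
  have h2 := (hC.2.1 w hw).2
  linarith

theorem IsCopula.lip {C : ℝ → ℝ → ℝ} (hC : IsCopula C) {x : ℝ} (hx : x ∈ Icc (0:ℝ) 1) :
    LipschitzOnWith 1 (C x) (Icc 0 1) := by
  apply LipschitzOnWith.of_le_add_mul
  intro v hv w hw
  rw [NNReal.coe_one, one_mul, Real.dist_eq]
  rcases le_total v w with h | h
  · have := hC.mono hx hv hw h
    have := abs_nonneg (v - w)
    linarith
  · have := hC.sub_le hx hw hv h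
    have := le_abs_self (v - w)
    linarith

theorem IsCopula.ftc {C : ℝ → ℝ → ℝ} (hC : IsCopula C) {x a b : ℝ} (hx : x ∈ Icc (0:ℝ) 1)
    (ha : a ∈ Icc (0:ℝ) 1) (hb : b ∈ Icc (0:ℝ) 1) :
    ∫ v in a..b, deriv (C x) v = C x b - C x a := by
  apply AbsolutelyContinuousOnInterval.integral_deriv_eq_sub
  apply LipschitzOnWith.absolutelyContinuousOnInterval (K := 1)
  exact (hC.lip hx).mono (uIcc_subset_Icc ha hb)

theorem mono_ae_diff {F : ℝ → ℝ} (hF : MonotoneOn F (Icc 0 1)) :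
    ∀ᵐ v, v ∈ Ioo (0:ℝ) 1 → DifferentiableAt ℝ F v := by
  filter_upwards [hF.ae_differentiableWithinAt_of_mem] with v hv h
  exact (hv (Ioo_subset_Icc_self h)).differentiableAt (Icc_mem_nhds h.1 h.2)

theorem mono_deriv_nonneg {F : ℝ → ℝ} (hF : MonotoneOn F (Icc 0 1)) {v : ℝ}
    (hv : v ∈ Ioo (0:ℝ) 1) : 0 ≤ deriv F v := by
  have h := hF.derivWithin_nonneg (x := v)
  rwa [derivWithin_of_mem_nhds (Icc_mem_nhds hv.1 hv.2)] at h

theorem IsCopula.deriv_bd {C : ℝ → ℝ → ℝ} (hC : IsCopula C) {x v : ℝ} (hx : x ∈ Icc (0:ℝ) 1)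
    (hv : v ∈ Ioo (0:ℝ) 1) : 0 ≤ deriv (C x) v ∧ deriv (C x) v ≤ 1 := by
  refine ⟨mono_deriv_nonneg (hC.mono hx) hv, ?_⟩
  have := norm_deriv_le_of_lipschitzOn (Icc_mem_nhds hv.1 hv.2) (hC.lip hx)
  rw [Real.norm_eq_abs] at this
  exact (le_abs_self _).trans (by simpa using this)

theorem ae_Ioo {p : ℝ → Prop} (h : ∀ᵐ v, v ∈ Ioo (0:ℝ) 1 → p v) :
    ∀ᵐ v ∂(volume.restrict (Icc (0:ℝ) 1)), p v := by
  rw [← restrict_Ioo_eq_restrict_Icc]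
  exact (ae_restrict_iff' measurableSet_Ioo).2 h

theorem ae_Ioo' {p : ℝ → Prop} (h : ∀ᵐ v ∂(volume.restrict (Icc (0:ℝ) 1)), p v) :
    ∀ᵐ v, v ∈ Ioo (0:ℝ) 1 → p v := by
  rw [← restrict_Ioo_eq_restrict_Icc] at h
  exact (ae_restrict_iff' measurableSet_Ioo).1 h

theorem intInt_iff {g : ℝ → ℝ} : IntegrableOn g (Icc (0:ℝ) 1) ↔ IntervalIntegrable g volume 0 1 := by
  rw [intervalIntegrable_iff_integrableOn_Icc_of_le zero_le_one]

theorem integral_congr_Ioo {f g : ℝ → ℝ} (h : ∀ᵐ v, v ∈ Ioo (0:ℝ) 1 → f v = g v) :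
    ∫ v in (0:ℝ)..1, f v = ∫ v in (0:ℝ)..1, g v := by
  rw [intervalIntegral.integral_of_le zero_le_one, intervalIntegral.integral_of_le zero_le_one,
    ← integral_Icc_eq_integral_Ioc, ← integral_Icc_eq_integral_Ioc]
  exact integral_congr_ae (ae_Ioo h)

noncomputable def FF (C : ℝ → ℝ → ℝ) (f : ℝ → ℝ) (x : ℝ) : ℝ :=
  ∫ v in (0:ℝ)..1, deriv (C x) v * f v

theorem IsCopula.integrable {C : ℝ → ℝ → ℝ} (hC : IsCopula C) {x : ℝ} (hx : x ∈ Icc (0:ℝ) 1)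
    {f : ℝ → ℝ} (hf : IntegrableOn f (Icc 0 1)) :
    IntegrableOn (fun v => deriv (C x) v * f v) (Icc 0 1) := by
  apply Integrable.bdd_mul (c := 1) hf (measurable_deriv _).aestronglyMeasurable
  apply ae_Ioo
  filter_upwards with v hv
  rw [Real.norm_eq_abs, abs_of_nonneg (hC.deriv_bd hx hv).1]
  exact (hC.deriv_bd hx hv).2

theorem FF_mono {C : ℝ → ℝ → ℝ} (hC : IsCopula C) {f : ℝ → ℝ} (hf : IntegrableOn f (Icc 0 1))
    (hf0 : ∀ x, 0 ≤ f x) : MonotoneOn (FF C f) (Icc 0 1) := by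
  intro x hx y hy hxy
  unfold FF
  apply intervalIntegral.integral_mono_ae_restrict zero_le_one
  · exact intInt_iff.1 (hC.integrable hx hf)
  · exact intInt_iff.1 (hC.integrable hy hf)
  apply ae_Ioo
  filter_upwards [mono_ae_diff (hC.mono hx), mono_ae_diff (hC.mono hy)] with v h1 h2 hv
  have := mono_deriv_nonneg (hC.mono_sub hx hy hxy) hv
  rw [deriv_fun_sub (h2 hv) (h1 hv)] at this
  exact mul_le_mul_of_nonneg_right (by linarith) (hf0 v)

theorem FF_ae_diff {C : ℝ → ℝ → ℝ} (hC : IsCopula C) {f : ℝ → ℝ} (hf : IntegrableOn f (Icc 0 1)) :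
    ∀ᵐ x, x ∈ Ioo (0:ℝ) 1 → DifferentiableAt ℝ (FF C f) x := by
  have hp : IntegrableOn (fun x => max (f x) 0) (Icc 0 1) := hf.pos_part
  have hn : IntegrableOn (fun x => max (-f x) 0) (Icc 0 1) := hf.neg_part
  have h1 := mono_ae_diff (FF_mono hC hp (fun x => le_max_right _ _))
  have h2 := mono_ae_diff (FF_mono hC hn (fun x => le_max_right _ _))
  filter_upwards [h1, h2] with x h1 h2 hx
  refine ((h1 hx).sub (h2 hx)).congr_of_eventuallyEq ?_
  filter_upwards [Ioo_mem_nhds hx.1 hx.2] with y hy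
  have hy' := Ioo_subset_Icc_self hy
  simp only [Pi.sub_apply]
  unfold FF
  rw [← intervalIntegral.integral_sub (intInt_iff.1 (hC.integrable hy' hp))
    (intInt_iff.1 (hC.integrable hy' hn))]
  congr 1
  ext v
  rw [← mul_sub]
  congr 1
  rcases le_total (f v) 0 with h | h
  · rw [max_eq_right h, max_eq_left (by linarith)]; ring
  · rw [max_eq_left h, max_eq_right (by linarith)]; ring

/-- points with C x x = x -/
theorem IsCopula.min {C : ℝ → ℝ → ℝ} (hC : IsCopula C) {x v : ℝ} (hx : x ∈ Icc (0:ℝ) 1)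
    (h : C x x = x) (hv : v ∈ Icc (0:ℝ) 1) : C x v = min x v := by
  rcases le_total x v with hxv | hxv
  · have h1 := hC.mono hx hx hv hxv
    have h2 := hC.mono hx hv (by simp) hv.2
    rw [(hC.1 x hx).2] at h2
    rw [min_eq_left hxv]; linarith
  · have h1 := hC.sub_le hx hv hx hxv
    have h2 := hC.swap.mono hv hx (by simp) hx.2
    simp only [(hC.2.1 v hv).2] at h2
    rw [min_eq_right hxv]; linarith

theorem FF_fix {C : ℝ → ℝ → ℝ} (hC : IsCopula C) {x : ℝ} (hx : x ∈ Icc (0:ℝ) 1)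
    (h : C x x = x) {f : ℝ → ℝ} (hf : IntegrableOn f (Icc 0 1)) :
    FF C f x = ∫ t in (0:ℝ)..x, f t := by
  have hi := intInt_iff.1 hf
  have hix : IntervalIntegrable f volume 0 x := hi.mono_set (by
    rw [uIcc_of_le hx.1, uIcc_of_le zero_le_one]; exact Icc_subset_Icc_right hx.2)
  have : FF C f x = ∫ v in (0:ℝ)..1, (Iic x).indicator f v := by
    apply integral_congr_Ioo
    filter_upwards [compl_mem_ae_iff.2 (measure_singleton x)] with v hvx hv
    have hd : deriv (C x) v = if v ≤ x then 1 else 0 := by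
      rcases lt_or_gt_of_ne (show v ≠ x from hvx) with hlt | hlt
      · rw [if_pos hlt.le]
        have : C x =ᶠ[nhds v] id := by
          filter_upwards [Ioo_mem_nhds hv.1 hlt] with w hw
          rw [hC.min hx h ⟨hw.1.le, hw.2.le.trans hx.2⟩, min_eq_right hw.2.le]; rfl
        rw [this.deriv_eq, deriv_id]
      · rw [if_neg hlt.not_ge]
        have : C x =ᶠ[nhds v] fun _ => x := by
          filter_upwards [Ioo_mem_nhds hlt hv.2] with w hw
          rw [hC.min hx h ⟨hx.1.trans hw.1.le, hw.2.le⟩, min_eq_left hw.1.le]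
        rw [this.deriv_eq, deriv_const]
    rw [hd]
    by_cases hh : v ≤ x <;> simp [hh]
  rw [this]
  exact intervalIntegral.integral_indicator hx

theorem FF_ind {C : ℝ → ℝ → ℝ} (hC : IsCopula C) {x v : ℝ} (hx : x ∈ Icc (0:ℝ) 1)
    (hv : v ∈ Icc (0:ℝ) 1) : FF C ((Iic v).indicator 1) x = C x v := by
  have : FF C ((Iic v).indicator 1) x = ∫ t in (0:ℝ)..1, (Iic v).indicator (deriv (C x)) t := by
    unfold FF
    congr 1
    ext t
    by_cases hh : t ≤ v <;> simp [hh]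
  rw [this, show (∫ t in (0:ℝ)..1, (Iic v).indicator (deriv (C x)) t) = _ from
    intervalIntegral.integral_indicator hv, hC.ftc hx (by simp) hv, (hC.1 x hx).1, sub_zero]

theorem FF_conv {C : ℝ → ℝ → ℝ} (hC : IsCopula C) {x a b r s : ℝ} (hx : x ∈ Icc (0:ℝ) 1)
    (ha : a ∈ Icc (0:ℝ) 1) (hb : b ∈ Icc (0:ℝ) 1)
    (h : ∀ v ∈ Icc (0:ℝ) 1, C x v = r * C a v + s * C b v)
    {f : ℝ → ℝ} (hf : IntegrableOn f (Icc 0 1)) :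
    FF C f x = r * FF C f a + s * FF C f b := by
  unfold FF
  rw [← intervalIntegral.integral_const_mul, ← intervalIntegral.integral_const_mul,
    ← intervalIntegral.integral_add ((intInt_iff.1 (hC.integrable ha hf)).const_mul r)
      ((intInt_iff.1 (hC.integrable hb hf)).const_mul s)]
  apply integral_congr_Ioo
  filter_upwards [mono_ae_diff (hC.mono ha), mono_ae_diff (hC.mono hb)] with v h1 h2 hv
  have : C x =ᶠ[nhds v] fun v => r * C a v + s * C b v := by
    filter_upwards [Ioo_mem_nhds hv.1 hv.2] with w hw
    exact h w (Ioo_subset_Icc_self hw)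
  rw [this.deriv_eq, deriv_fun_add ((h1 hv).const_mul r) ((h2 hv).const_mul s),
    deriv_const_mul_field, deriv_const_mul_field]
  ring

theorem ind_integrable (v : ℝ) : IntegrableOn ((Iic v).indicator (1 : ℝ → ℝ)) (Icc (0:ℝ) 1) := by
  apply Integrable.indicator _ measurableSet_Iic
  exact integrableOn_const (by simp)

theorem bathtub {C : ℝ → ℝ → ℝ} (hC : IsCopula C) {s c : ℝ} (hs : s ∈ Icc (0:ℝ) 1)
    {φ : ℝ → ℝ} (hφ : IntegrableOn φ (Icc 0 1))
    (h1 : ∀ t ∈ Ioo (0:ℝ) 1, t < s → c < φ t) (h2 : ∀ t ∈ Ioo (0:ℝ) 1, s < t → φ t ≤ c)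
    (h : FF C φ s = ∫ t in (0:ℝ)..s, φ t) : C s s = s := by
  set J : ℝ → ℝ := (Iic s).indicator 1 with hJ
  have iJ : IntegrableOn J (Icc 0 1) := ind_integrable s
  have i1 : IntegrableOn (fun t => J t * φ t) (Icc 0 1) := by
    have : (fun t => J t * φ t) = (Iic s).indicator φ := by
      ext t; by_cases hh : t ≤ s <;> simp [hJ, hh]
    rw [this]; exact Integrable.indicator hφ measurableSet_Iic
  have e1 : ∫ t in (0:ℝ)..1, J t * φ t = ∫ t in (0:ℝ)..s, φ t := by
    have : (fun t => J t * φ t) = (Iic s).indicator φ := by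
      ext t; by_cases hh : t ≤ s <;> simp [hJ, hh]
    rw [this]; exact intervalIntegral.integral_indicator hs
  have e2 : ∫ t in (0:ℝ)..1, J t = s := by
    rw [show (∫ t in (0:ℝ)..1, J t) = _ from intervalIntegral.integral_indicator hs]
    simp
  have i0 : IntegrableOn (deriv (C s)) (Icc 0 1) := by
    have := hC.integrable hs (f := fun _ => 1) (integrableOn_const (by simp))
    simpa using this
  have i2 := hC.integrable hs hφ
  have e3 : ∫ t in (0:ℝ)..1, deriv (C s) t = s := by
    rw [hC.ftc hs (by simp) (by simp), (hC.1 s hs).1, (hC.1 s hs).2, sub_zero]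
  have hA := (intInt_iff.1 i1).sub (intInt_iff.1 i2)
  have hB := ((intInt_iff.1 iJ).sub (intInt_iff.1 i0)).const_mul c
  have tot : ∫ t in (0:ℝ)..1, ((J t * φ t - deriv (C s) t * φ t) - c * (J t - deriv (C s) t)) = 0 := by
    rw [intervalIntegral.integral_sub hA hB, intervalIntegral.integral_const_mul,
      intervalIntegral.integral_sub (intInt_iff.1 i1) (intInt_iff.1 i2),
      intervalIntegral.integral_sub (intInt_iff.1 iJ) (intInt_iff.1 i0), e1, e2, e3, ← h]
    unfold FF
    ring
  have hnn : 0 ≤ᵐ[volume.restrict (Ioc (0:ℝ) 1)]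
      fun t => ((J t * φ t - deriv (C s) t * φ t) - c * (J t - deriv (C s) t)) := by
    rw [restrict_Ioc_eq_restrict_Icc]
    apply ae_Ioo
    filter_upwards [compl_mem_ae_iff.2 (measure_singleton s)] with v hvs hv
    have hd := hC.deriv_bd hs hv
    have heq : ((J v * φ v - deriv (C s) v * φ v) - c * (J v - deriv (C s) v))
      = (J v - deriv (C s) v) * (φ v - c) := by ring
    rw [heq, Pi.zero_apply]
    rcases lt_or_gt_of_ne (show v ≠ s from hvs) with hlt | hlt
    · have : J v = 1 := by simp [hJ, hlt.le]
      rw [this]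
      exact mul_nonneg (by linarith) (by linarith [h1 v hv hlt])
    · have : J v = 0 := by simp [hJ, hlt]
      rw [this]
      exact mul_nonneg_of_nonpos_of_nonpos (by linarith) (by linarith [h2 v hv hlt])
  rw [intervalIntegral.integral_eq_zero_iff_of_le_of_nonneg_ae zero_le_one hnn (hA.sub hB)] at tot
  rw [restrict_Ioc_eq_restrict_Icc] at tot
  have tot' := ae_Ioo' tot
  have := FF_ind hC hs hs
  rw [← this]
  conv_rhs => rw [← e2]
  apply integral_congr_Ioo
  filter_upwards [tot', compl_mem_ae_iff.2 (measure_singleton s)] with v hv hvs hv'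
  have hh := hv hv'
  rcases lt_or_gt_of_ne (show v ≠ s from hvs) with hlt | hlt
  · have hJ1 : J v = 1 := by simp [hJ, hlt.le]
    have h0 : (1 - deriv (C s) v) * (φ v - c) = 0 := by
      simp only [hJ1, Pi.zero_apply] at hh
      linarith
    have := h1 v hv' hlt
    rcases mul_eq_zero.1 h0 with h0 | h0
    · change deriv (C s) v * J v = J v
      rw [hJ1]; linarith
    · linarith
  · have hJ1 : J v = 0 := by simp [hJ, hlt]
    change deriv (C s) v * J v = J v
    rw [hJ1]; ring

/-- Invariant antitone version of the derivative. -/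
def Good (C : ℝ → ℝ → ℝ) : Prop := ∀ v ∈ Icc (0:ℝ) 1, ∃ φ : ℝ → ℝ, AntitoneOn φ (Icc 0 1) ∧
  ∀ᵐ u, u ∈ Ioo (0:ℝ) 1 → deriv (fun s => C s v) u = φ u

theorem FF_congr {C : ℝ → ℝ → ℝ} {f g : ℝ → ℝ}
    (h : ∀ᵐ v, v ∈ Ioo (0:ℝ) 1 → f v = g v) (x : ℝ) : FF C f x = FF C g x := by
  apply integral_congr_Ioo
  filter_upwards [h] with v hv h'
  rw [hv h']

theorem good_of_antitone {C : ℝ → ℝ → ℝ} (hC : IsCopula C)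
    (H : ∀ f : ℝ → ℝ, IntegrableOn f (Icc (0:ℝ) 1) →
        (∃ g : ℝ → ℝ, AntitoneOn g (Icc (0:ℝ) 1) ∧
          f =ᵐ[volume.restrict (Icc (0:ℝ) 1)] g) →
        ∃ h : ℝ → ℝ, AntitoneOn h (Icc (0:ℝ) 1) ∧
          MarkovOp C f =ᵐ[volume.restrict (Icc (0:ℝ) 1)] h) : Good C := by
  intro v hv
  have hanti : Antitone ((Iic v).indicator (1 : ℝ → ℝ)) := by
    intro a b hab
    by_cases h1 : b ≤ v
    · simp [h1, hab.trans h1]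
    · rw [indicator_of_notMem (by simpa using h1)]
      exact indicator_nonneg (by simp) _
  obtain ⟨h, hh, he⟩ := H _ (ind_integrable v) ⟨_, hanti.antitoneOn _, EventuallyEq.rfl⟩
  refine ⟨h, hh, ?_⟩
  filter_upwards [ae_Ioo' he] with u hu hu'
  rw [← hu hu']
  change _ = deriv (FF C _) u
  apply EventuallyEq.deriv_eq
  filter_upwards [Ioo_mem_nhds hu'.1 hu'.2] with w hw
  exact (FF_ind hC (Ioo_subset_Icc_self hw) hv).symm

theorem good_of_monotone {C : ℝ → ℝ → ℝ} (hC : IsCopula C)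
    (hid : ∀ u ∈ Icc (0:ℝ) 1, ∀ v ∈ Icc (0:ℝ) 1, MarkovProduct C C u v = C u v)
    (H : ∀ f : ℝ → ℝ, IntegrableOn f (Icc (0:ℝ) 1) →
        (∃ g : ℝ → ℝ, AntitoneOn g (Icc (0:ℝ) 1) ∧
          f =ᵐ[volume.restrict (Icc (0:ℝ) 1)] g) →
        ∃ h : ℝ → ℝ, MonotoneOn h (Icc (0:ℝ) 1) ∧
          MarkovOp C f =ᵐ[volume.restrict (Icc (0:ℝ) 1)] h) : Good C := by
  intro v hv
  have hanti : Antitone ((Iic v).indicator (1 : ℝ → ℝ)) := by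
    intro a b hab
    by_cases h1 : b ≤ v
    · simp [h1, hab.trans h1]
    · rw [indicator_of_notMem (by simpa using h1)]
      exact indicator_nonneg (by simp) _
  obtain ⟨h, hh, he⟩ := H _ (ind_integrable v) ⟨_, hanti.antitoneOn _, EventuallyEq.rfl⟩
  have he' : ∀ᵐ u, u ∈ Ioo (0:ℝ) 1 → deriv (fun s => C s v) u = h u := by
    filter_upwards [ae_Ioo' he] with u hu hu'
    rw [← hu hu']
    change _ = deriv (FF C _) u
    apply EventuallyEq.deriv_eq
    filter_upwards [Ioo_mem_nhds hu'.1 hu'.2] with w hw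
    exact (FF_ind hC (Ioo_subset_Icc_self hw) hv).symm
  have ih : IntegrableOn h (Icc 0 1) := hh.integrableOn_isCompact isCompact_Icc
  obtain ⟨k, hk, hke⟩ := H _ ih.neg ⟨_, hh.neg, EventuallyEq.rfl⟩
  refine ⟨-k, hk.neg, ?_⟩
  filter_upwards [ae_Ioo' hke] with u hu hu'
  rw [Pi.neg_apply, ← hu hu']
  change _ = -deriv (FF C _) u
  rw [← deriv.fun_neg]
  apply EventuallyEq.deriv_eq
  filter_upwards [Ioo_mem_nhds hu'.1 hu'.2] with w hw
  have hw' := Ioo_subset_Icc_self hw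
  rw [← hid w hw' v hv]
  change FF C (deriv (fun s => C s v)) w = _
  rw [FF_congr he']
  unfold FF
  rw [← intervalIntegral.integral_neg]
  simp

theorem good_affine {C : ℝ → ℝ → ℝ} (hC : IsCopula C)
    (hid : ∀ u ∈ Icc (0:ℝ) 1, ∀ v ∈ Icc (0:ℝ) 1, MarkovProduct C C u v = C u v)
    (hG : Good C) {a b : ℝ} (ha : 0 ≤ a) (hab : a < b) (hb : b ≤ 1)
    (hne : ∀ t ∈ Ioo a b, C t t ≠ t) {u v : ℝ} (hu : u ∈ Icc a b) (hv : v ∈ Icc (0:ℝ) 1) :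
    C u v = (1 - (u - a) / (b - a)) * C a v + ((u - a) / (b - a)) * C b v := by
  obtain ⟨φ, hφ, he⟩ := hG v hv
  have iφ : IntegrableOn φ (Icc 0 1) := hφ.integrableOn_isCompact isCompact_Icc
  have hsub : ∀ t ∈ Ioo a b, t ∈ Icc (0:ℝ) 1 := fun t ht => ⟨ha.trans ht.1.le, ht.2.le.trans hb⟩
  have hCint : ∀ s ∈ Icc (0:ℝ) 1, C s v = ∫ t in (0:ℝ)..s, φ t := by
    intro s hs
    have h1 := hC.swap.ftc hv (a := 0) (b := s) (by simp) hs
    simp only [(hC.2.1 v hv).1, sub_zero] at h1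
    rw [← h1]
    apply intervalIntegral.integral_congr_ae
    filter_upwards [he, compl_mem_ae_iff.2 (measure_singleton (1:ℝ))] with t ht ht1 hts
    rw [uIoc_of_le hs.1] at hts
    exact ht ⟨hts.1, lt_of_le_of_ne (hts.2.trans hs.2) ht1⟩
  have hconst : ∀ x ∈ Ioo a b, ∀ y ∈ Ioo a b, x < y → φ x = φ y := by
    intro x hx y hy hxy
    by_contra hne'
    have hlt : φ y < φ x := lt_of_le_of_ne (hφ (hsub x hx) (hsub y hy) hxy.le) (Ne.symm hne')
    set S : Set ℝ := {t | t ∈ Icc (0:ℝ) 1 ∧ φ y < φ t} with hS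
    have hxS : x ∈ S := ⟨hsub x hx, hlt⟩
    have hSb : ∀ t ∈ S, t ≤ y := by
      intro t ht
      by_contra hty
      have := hφ (hsub y hy) ht.1 (not_le.1 hty).le
      linarith [ht.2]
    have hbdd : BddAbove S := ⟨y, hSb⟩
    set s := sSup S
    have h1 : x ≤ s := le_csSup hbdd hxS
    have h2 : s ≤ y := csSup_le ⟨x, hxS⟩ hSb
    have hs : s ∈ Ioo a b := ⟨hx.1.trans_le h1, h2.trans_lt hy.2⟩
    apply hne s hs
    apply bathtub hC (hsub s hs) iφ (c := φ y)
    · intro t ht hts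
      obtain ⟨r, hr, htr⟩ := exists_lt_of_lt_csSup ⟨x, hxS⟩ hts
      exact hr.2.trans_le (hφ (Ioo_subset_Icc_self ht) hr.1 htr.le)
    · intro t ht hst
      by_contra hc
      exact absurd (le_csSup hbdd (show t ∈ S from ⟨Ioo_subset_Icc_self ht, not_le.1 hc⟩)) hst.not_ge
    · rw [← hCint s (hsub s hs), ← hid s (hsub s hs) v hv]
      exact (FF_congr he s).symm
  have hm : (a + b) / 2 ∈ Ioo a b := ⟨by linarith, by linarith⟩
  set κ := φ ((a + b) / 2)
  have hκ : ∀ t ∈ Ioo a b, φ t = κ := by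
    intro t ht
    rcases lt_trichotomy t ((a + b) / 2) with h | h | h
    · exact hconst _ ht _ hm h
    · rw [h]
    · exact (hconst _ hm _ ht h).symm
  have hlin : ∀ w ∈ Icc a b, C w v = C a v + κ * (w - a) := by
    intro w hw
    have ha' : a ∈ Icc (0:ℝ) 1 := ⟨ha, hab.le.trans hb⟩
    have hw' : w ∈ Icc (0:ℝ) 1 := ⟨ha.trans hw.1, hw.2.trans hb⟩
    have hii : ∀ z ∈ Icc (0:ℝ) 1, IntervalIntegrable φ volume 0 z := fun z hz =>
      (intInt_iff.1 iφ).mono_set (by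
        rw [uIcc_of_le hz.1, uIcc_of_le zero_le_one]; exact Icc_subset_Icc_right hz.2)
    have h1 := intervalIntegral.integral_interval_sub_left (hii w hw') (hii a ha')
    rw [← hCint w hw', ← hCint a ha'] at h1
    have h2 : ∫ t in a..w, φ t = ∫ t in a..w, κ := by
      apply intervalIntegral.integral_congr_ae
      filter_upwards [compl_mem_ae_iff.2 (measure_singleton b)] with t ht1 hts
      rw [uIoc_of_le hw.1] at hts
      exact hκ t ⟨hts.1, lt_of_le_of_ne (hts.2.trans hw.2) ht1⟩
    rw [h2, intervalIntegral.integral_const, smul_eq_mul] at h1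
    linarith
  have hpos : b - a ≠ 0 := by linarith
  rw [hlin u hu, hlin b ⟨hab.le, le_rfl⟩]
  field_simp
  ring

theorem exists_comp {C : ℝ → ℝ → ℝ} (hC : IsCopula C) {t : ℝ} (ht : t ∈ Icc (0:ℝ) 1)
    (hne : C t t ≠ t) : ∃ a b, 0 ≤ a ∧ a < b ∧ b ≤ 1 ∧ C a a = a ∧ C b b = b ∧
      (∀ s ∈ Ioo a b, C s s ≠ s) ∧ t ∈ Ioo a b := by
  have hcont : ContinuousOn (fun s => C s s) (Icc 0 1) := by
    have : LipschitzOnWith 2 (fun s => C s s) (Icc 0 1) := by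
      apply LipschitzOnWith.of_dist_le_mul
      intro x hx y hy
      have h1 := (hC.lip hx).dist_le_mul x hx y hy
      have h2 := (hC.swap.lip hy).dist_le_mul x hx y hy
      have h3 := dist_triangle (C x x) (C x y) (C y y)
      simp only [NNReal.coe_one, one_mul] at h1 h2
      have : ((2 : NNReal) : ℝ) = 2 := rfl
      rw [this]
      linarith
    exact this.continuousOn
  set K : Set ℝ := {s | s ∈ Icc (0:ℝ) 1 ∧ C s s = s} with hK
  have hKc : IsClosed K := isClosed_Icc.isClosed_eq hcont continuousOn_id
  have h0 : (0:ℝ) ∈ K := ⟨by simp, (hC.1 0 (by simp)).1⟩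
  have h1 : (1:ℝ) ∈ K := ⟨by simp, (hC.1 1 (by simp)).2⟩
  have hA : IsCompact (K ∩ Icc 0 t) := isCompact_Icc.inter_left hKc
  have hB : IsCompact (K ∩ Icc t 1) := isCompact_Icc.inter_left hKc
  obtain ⟨a, ⟨haK, ha⟩, hamax⟩ := hA.exists_isGreatest ⟨0, h0, le_rfl, ht.1⟩
  obtain ⟨b, ⟨hbK, hb⟩, hbmin⟩ := hB.exists_isLeast ⟨1, h1, ht.2, le_rfl⟩
  have hat : a ≠ t := fun h => hne (h ▸ haK.2)
  have hbt : t ≠ b := fun h => hne (h ▸ hbK.2)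
  have hat' := lt_of_le_of_ne ha.2 hat
  have hbt' := lt_of_le_of_ne hb.1 hbt
  refine ⟨a, b, ha.1, hat'.trans hbt', hb.2, haK.2, hbK.2, ?_, hat', hbt'⟩
  intro s hs hss
  have hsK : s ∈ K := ⟨⟨ha.1.trans hs.1.le, hs.2.le.trans hb.2⟩, hss⟩
  rcases le_total s t with h | h
  · exact absurd (hamax ⟨hsK, hsK.1.1, h⟩) hs.1.not_ge
  · exact absurd (hbmin ⟨hsK, h, hsK.1.2⟩) hs.2.not_ge

theorem forward {C : ℝ → ℝ → ℝ} (hC : IsCopula C)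
    (hid : ∀ u ∈ Icc (0:ℝ) 1, ∀ v ∈ Icc (0:ℝ) 1, MarkovProduct C C u v = C u v)
    (hG : Good C) : ∃ I : Set (ℝ × ℝ), I.Countable ∧
      (∀ p ∈ I, 0 ≤ p.1 ∧ p.1 < p.2 ∧ p.2 ≤ 1) ∧
      (I.PairwiseDisjoint fun p => Ioo p.1 p.2) ∧
      ∀ f : ℝ → ℝ, IntegrableOn f (Icc (0:ℝ) 1) →
        ∀ᵐ u ∂(volume.restrict (Icc (0:ℝ) 1)),
          (∀ p ∈ I, u ∈ Ioo p.1 p.2 →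
            MarkovOp C f u = (p.2 - p.1)⁻¹ * ∫ t in p.1..p.2, f t) ∧
          (u ∉ ⋃ p ∈ I, Ioo p.1 p.2 → MarkovOp C f u = f u) := by
  set I : Set (ℝ × ℝ) := {p | 0 ≤ p.1 ∧ p.1 < p.2 ∧ p.2 ≤ 1 ∧ C p.1 p.1 = p.1 ∧ C p.2 p.2 = p.2 ∧
      (∀ s ∈ Ioo p.1 p.2, C s s ≠ s)} with hI
  have hdis : I.PairwiseDisjoint fun p => Ioo p.1 p.2 := by
    rintro ⟨a, b⟩ ⟨-, hab, -, ha, hb, hn⟩ ⟨a', b'⟩ ⟨-, hab', -, ha', hb', hn'⟩ hne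
    rw [Function.onFun, Set.disjoint_left]
    intro t ht ht'
    simp only at *
    apply hne
    have e1 : a = a' := by
      rcases lt_trichotomy a a' with h | h | h
      · exact absurd ha' (hn a' ⟨h, ht'.1.trans ht.2⟩)
      · exact h
      · exact absurd ha (hn' a ⟨h, ht.1.trans ht'.2⟩)
    have e2 : b = b' := by
      rcases lt_trichotomy b b' with h | h | h
      · exact absurd hb (hn' b ⟨ht'.1.trans ht.2, h⟩)
      · exact h
      · exact absurd hb' (hn b' ⟨ht.1.trans ht'.2, h⟩)
    rw [e1, e2]
  refine ⟨I, ?_, fun p hp => ⟨hp.1, hp.2.1, hp.2.2.1⟩, hdis, ?_⟩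
  · exact hdis.countable_of_isOpen (fun _ _ => isOpen_Ioo) fun p hp => nonempty_Ioo.2 hp.2.1
  intro f hf
  apply ae_Ioo
  set K : Set ℝ := {s | s ∈ Icc (0:ℝ) 1 ∧ C s s = s} with hK
  have hcount := (countable_setOfPred_isolated_right_within (s := K)).ae_notMem volume
  have hL := (intInt_iff.1 hf).ae_hasDerivAt_integral
  filter_upwards [hcount, hL, FF_ae_diff hC hf] with u hu1 hu2 hu3 hu
  have hii : ∀ z ∈ Icc (0:ℝ) 1, IntervalIntegrable f volume 0 z := fun z hz =>
      (intInt_iff.1 hf).mono_set (by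
        rw [uIcc_of_le hz.1, uIcc_of_le zero_le_one]; exact Icc_subset_Icc_right hz.2)
  constructor
  · rintro ⟨a, b⟩ ⟨h0a, hab, hb1, ha, hb, hn⟩ hup
    simp only at *
    have ha' : a ∈ Icc (0:ℝ) 1 := ⟨h0a, hab.le.trans hb1⟩
    have hb' : b ∈ Icc (0:ℝ) 1 := ⟨h0a.trans hab.le, hb1⟩
    have hev : FF C f =ᶠ[nhds u] fun x => (1 - (x - a) / (b - a)) * FF C f a +
        ((x - a) / (b - a)) * FF C f b := by
      filter_upwards [Ioo_mem_nhds hup.1 hup.2] with x hx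
      apply FF_conv hC ⟨h0a.trans hx.1.le, hx.2.le.trans hb1⟩ ha' hb' _ hf
      intro v hv
      exact good_affine hC hid hG h0a hab hb1 hn (Ioo_subset_Icc_self hx) hv
    change deriv (FF C f) u = _
    rw [hev.deriv_eq]
    have hd1 : HasDerivAt (fun x : ℝ => (x - a) / (b - a)) (1 / (b - a)) u :=
      ((hasDerivAt_id u).sub_const a).div_const _
    have hd := ((hd1.const_sub 1).mul_const (FF C f a)).add (hd1.mul_const (FF C f b))
    refine hd.deriv.trans ?_
    rw [FF_fix hC ha' ha hf, FF_fix hC hb' hb hf,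
      ← intervalIntegral.integral_interval_sub_left (hii b hb') (hii a ha')]
    ring
  · intro hnot
    have huc : C u u = u := by
      by_contra hne
      obtain ⟨a, b, h1, h2, h3, h4, h5, h6, h7⟩ := exists_comp hC (Ioo_subset_Icc_self hu) hne
      apply hnot
      exact mem_biUnion (show (a, b) ∈ I from ⟨h1, h2, h3, h4, h5, h6⟩) h7
    have huK : u ∈ K := ⟨Ioo_subset_Icc_self hu, huc⟩
    have hacc : nhdsWithin u (K ∩ Ioi u) ≠ ⊥ := fun h => hu1 ⟨huK, h⟩
    have hG1 := (hu2 (by rw [uIcc_of_le zero_le_one]; exact Ioo_subset_Icc_self hu) 0 (by simp))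
    have hF1 := (hu3 hu).hasDerivAt
    have hF2 : HasDerivWithinAt (FF C f) (f u) (K ∩ Ioi u) u := by
      apply (hG1.hasDerivWithinAt (s := K ∩ Ioi u)).congr
      · intro x hx
        exact FF_fix hC hx.1.1 hx.1.2 hf
      · exact FF_fix hC huK.1 huK.2 hf
    have hU : UniqueDiffWithinAt ℝ (K ∩ Ioi u) u := by
      rw [uniqueDiffWithinAt_iff_accPt, accPt_principal_iff_nhdsWithin]
      have : (K ∩ Ioi u) \ {u} = K ∩ Ioi u := by
        ext x; simp only [Set.mem_sdiff, mem_inter_iff, mem_Ioi, mem_singleton_iff]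
        exact ⟨fun h => h.1, fun h => ⟨h, h.2.ne'⟩⟩
      rw [this]
      exact ⟨hacc⟩
    exact hU.eq_deriv _ hF1.hasDerivWithinAt hF2

theorem backward {C : ℝ → ℝ → ℝ} {I : Set (ℝ × ℝ)}
    (hI : ∀ p ∈ I, 0 ≤ p.1 ∧ p.1 < p.2 ∧ p.2 ≤ 1)
    (hdis : I.PairwiseDisjoint fun p => Ioo p.1 p.2)
    {f : ℝ → ℝ} (hf : IntegrableOn f (Icc (0:ℝ) 1))
    (h : ∀ᵐ u ∂(volume.restrict (Icc (0:ℝ) 1)),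
          (∀ p ∈ I, u ∈ Ioo p.1 p.2 →
            MarkovOp C f u = (p.2 - p.1)⁻¹ * ∫ t in p.1..p.2, f t) ∧
          (u ∉ ⋃ p ∈ I, Ioo p.1 p.2 → MarkovOp C f u = f u))
    (hg : ∃ g : ℝ → ℝ, AntitoneOn g (Icc (0:ℝ) 1) ∧
          f =ᵐ[volume.restrict (Icc (0:ℝ) 1)] g) :
    ∃ h : ℝ → ℝ, AntitoneOn h (Icc (0:ℝ) 1) ∧
          MarkovOp C f =ᵐ[volume.restrict (Icc (0:ℝ) 1)] h := by
  classical
  obtain ⟨g, hg, hfg⟩ := hg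
  have ig : IntegrableOn g (Icc 0 1) := hg.integrableOn_isCompact isCompact_Icc
  set A : ℝ × ℝ → ℝ := fun p => (p.2 - p.1)⁻¹ * ∫ t in p.1..p.2, f t with hA
  have hAg : ∀ p ∈ I, A p = (p.2 - p.1)⁻¹ * ∫ t in p.1..p.2, g t := by
    intro p hp
    obtain ⟨h1, h2, h3⟩ := hI p hp
    simp only [hA]
    congr 1
    apply intervalIntegral.integral_congr_ae
    filter_upwards [ae_Ioo' hfg, compl_mem_ae_iff.2 (measure_singleton (1:ℝ))] with t ht ht1 hts
    rw [uIoc_of_le h2.le] at hts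
    exact ht ⟨h1.trans_lt hts.1, lt_of_le_of_ne (hts.2.trans h3) ht1⟩
  have hpi : ∀ p ∈ I, IntervalIntegrable g volume p.1 p.2 := by
    intro p hp
    obtain ⟨h1, h2, h3⟩ := hI p hp
    exact (intInt_iff.1 ig).mono_set (by
        rw [uIcc_of_le h2.le, uIcc_of_le zero_le_one]; exact Icc_subset_Icc h1 h3)
  have hup : ∀ p ∈ I, A p ≤ g p.1 := by
    intro p hp
    obtain ⟨h1, h2, h3⟩ := hI p hp
    rw [hAg p hp, inv_mul_le_iff₀ (by linarith)]
    have := intervalIntegral.integral_mono_on h2.le (hpi p hp)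
      (intervalIntegrable_const (c := g p.1)) (fun x hx =>
        hg ⟨h1, h2.le.trans h3⟩ ⟨h1.trans hx.1, hx.2.trans h3⟩ hx.1)
    simpa using this
  have hlo : ∀ p ∈ I, g p.2 ≤ A p := by
    intro p hp
    obtain ⟨h1, h2, h3⟩ := hI p hp
    rw [hAg p hp, le_inv_mul_iff₀ (by linarith)]
    have := intervalIntegral.integral_mono_on h2.le 
      (intervalIntegrable_const (c := g p.2)) (hpi p hp) (fun x hx =>
        hg ⟨h1.trans hx.1, hx.2.trans h3⟩ ⟨h1.trans h2.le, h3⟩ hx.2)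
    simpa using this
  set k : ℝ → ℝ := fun u => if hu : ∃ p ∈ I, u ∈ Ioo p.1 p.2 then A hu.choose else g u with hk
  have huniq : ∀ p ∈ I, ∀ q ∈ I, ∀ u, u ∈ Ioo p.1 p.2 → u ∈ Ioo q.1 q.2 → p = q := by
    intro p hp q hq u h1 h2
    by_contra hne
    exact Set.disjoint_left.1 (hdis hp hq hne) h1 h2
  have hk1 : ∀ p ∈ I, ∀ u ∈ Ioo p.1 p.2, k u = A p := by
    intro p hp u hu
    have hex : ∃ p ∈ I, u ∈ Ioo p.1 p.2 := ⟨p, hp, hu⟩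
    simp only [hk, dif_pos hex]
    rw [huniq _ hex.choose_spec.1 p hp u hex.choose_spec.2 hu]
  have hk2 : ∀ u, (¬ ∃ p ∈ I, u ∈ Ioo p.1 p.2) → k u = g u := by
    intro u hu
    simp only [hk, dif_neg hu]
  refine ⟨k, ?_, ?_⟩
  · intro x hx y hy hxy
    by_cases hxp : ∃ p ∈ I, x ∈ Ioo p.1 p.2
    · obtain ⟨p, hp, hxp⟩ := hxp
      obtain ⟨p1, p2, p3⟩ := hI p hp
      rw [hk1 p hp x hxp]
      by_cases hyq : ∃ q ∈ I, y ∈ Ioo q.1 q.2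
      · obtain ⟨q, hq, hyq⟩ := hyq
        obtain ⟨q1, q2, q3⟩ := hI q hq
        rw [hk1 q hq y hyq]
        by_cases hpq : p = q
        · rw [hpq]
        have hle : p.2 ≤ q.1 := by
          by_contra hlt
          rw [not_le] at hlt
          rcases le_or_gt x q.1 with hc | hc
          · obtain ⟨z, hz1, hz2⟩ := exists_between (lt_min hlt q2)
            exact hpq (huniq p hp q hq z ⟨hxp.1.trans_le (hc.trans hz1.le),
              hz2.trans_le (min_le_left _ _)⟩ ⟨hz1, hz2.trans_le (min_le_right _ _)⟩)
          · exact hpq (huniq p hp q hq x hxp ⟨hc, hxy.trans_lt hyq.2⟩)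
        exact (hup q hq).trans ((hg ⟨p1.trans p2.le, p3⟩ ⟨q1, q2.le.trans q3⟩ hle).trans (hlo p hp))
      · rw [hk2 y hyq]
        have : p.2 ≤ y := by
          by_contra hlt
          exact hyq ⟨p, hp, hxp.1.trans_le hxy, not_le.1 hlt⟩
        exact (hg ⟨p1.trans p2.le, p3⟩ hy this).trans (hlo p hp)
    · rw [hk2 x hxp]
      by_cases hyq : ∃ q ∈ I, y ∈ Ioo q.1 q.2
      · obtain ⟨q, hq, hyq⟩ := hyq
        obtain ⟨q1, q2, q3⟩ := hI q hq
        rw [hk1 q hq y hyq]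
        have : x ≤ q.1 := by
          by_contra hlt
          exact hxp ⟨q, hq, not_le.1 hlt, hxy.trans_lt hyq.2⟩
        exact (hup q hq).trans (hg hx ⟨q1, q2.le.trans q3⟩ this)
      · rw [hk2 y hyq]
        exact hg hx hy hxy
  · filter_upwards [h, hfg] with u hu hu'
    by_cases hup : ∃ p ∈ I, u ∈ Ioo p.1 p.2
    · obtain ⟨p, hp, hup⟩ := hup
      rw [hk1 p hp u hup]
      exact hu.1 p hp hup
    · rw [hk2 u hup, hu.2 (fun hm => hup (by simpa only [mem_iUnion, exists_prop] using hm)), hu']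

theorem conditionalExpectation_monotone_iff_averaging (C : ℝ → ℝ → ℝ) (hC : IsCopula C)
    (hid : ∀ u ∈ Icc (0:ℝ) 1, ∀ v ∈ Icc (0:ℝ) 1, MarkovProduct C C u v = C u v) :
    ((∀ f : ℝ → ℝ, IntegrableOn f (Icc (0:ℝ) 1) →
        (∃ g : ℝ → ℝ, AntitoneOn g (Icc (0:ℝ) 1) ∧
          f =ᵐ[volume.restrict (Icc (0:ℝ) 1)] g) →
        ∃ h : ℝ → ℝ, AntitoneOn h (Icc (0:ℝ) 1) ∧
          MarkovOp C f =ᵐ[volume.restrict (Icc (0:ℝ) 1)] h) ∨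
     (∀ f : ℝ → ℝ, IntegrableOn f (Icc (0:ℝ) 1) →
        (∃ g : ℝ → ℝ, AntitoneOn g (Icc (0:ℝ) 1) ∧
          f =ᵐ[volume.restrict (Icc (0:ℝ) 1)] g) →
        ∃ h : ℝ → ℝ, MonotoneOn h (Icc (0:ℝ) 1) ∧
          MarkovOp C f =ᵐ[volume.restrict (Icc (0:ℝ) 1)] h)) ↔
    ∃ I : Set (ℝ × ℝ), I.Countable ∧
      (∀ p ∈ I, 0 ≤ p.1 ∧ p.1 < p.2 ∧ p.2 ≤ 1) ∧
      (I.PairwiseDisjoint fun p => Ioo p.1 p.2) ∧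
      ∀ f : ℝ → ℝ, IntegrableOn f (Icc (0:ℝ) 1) →
        ∀ᵐ u ∂(volume.restrict (Icc (0:ℝ) 1)),
          (∀ p ∈ I, u ∈ Ioo p.1 p.2 →
            MarkovOp C f u = (p.2 - p.1)⁻¹ * ∫ t in p.1..p.2, f t) ∧
          (u ∉ ⋃ p ∈ I, Ioo p.1 p.2 → MarkovOp C f u = f u) := by
  constructor
  · rintro (H | H)
    · exact forward hC hid (good_of_antitone hC H)
    · exact forward hC hid (good_of_monotone hC hid H)
  · rintro ⟨I, -, hI, hdis, H⟩
    left
    intro f hf hg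
    exact backward hI hdis hf (H f hf) hg
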